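/- Assume (A3). For every circle L ∈ ⟨p,K⟩, the relation ≡_L is an equivalence relation on the set P ∖ L. -/

import Mathlib

/-- A Laguerre plane: points, circles, and a parallelity relation. -/
structure LaguerrePlane (P : Type*) where
  Circles : Set (Set P)
  Par : P → P → Prop
  par_equiv : Equivalence Par
  joinCircle : ∀ a b c : P, ¬ Par a b → ¬ Par b c → ¬ Par a c →
    ∃! C, C ∈ Circles ∧ a ∈ C ∧ b ∈ C ∧ c ∈ C
  touching : ∀ K ∈ Circles, ∀ p ∈ K, ∀ q, q ∉ K → ¬ Par p q →
    ∃! C, C ∈ Circles ∧ q ∈ C ∧ K ∩ C = {p}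
  parPoint : ∀ (x : P), ∀ K ∈ Circles, ∃! q, Par x q ∧ q ∈ K
  nontriv : ∃ C ∈ Circles,
    (∃ a b c : P, a ∈ C ∧ b ∈ C ∧ c ∈ C ∧ a ≠ b ∧ b ≠ c ∧ a ≠ c) ∧ C ≠ Set.univ

namespace LaguerrePlane

variable {P : Type*}

/-- The generator (parallel class) of a point. -/
def gen (L : LaguerrePlane P) (p : P) : Set P := {q | L.Par p q}

/-- The pencil ⟨p,K⟩: the circle K together with all circles tangent to K at p. -/
def pencil (L : LaguerrePlane P) (p : P) (K : Set P) : Set (Set P) :=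
  insert K {M | M ∈ L.Circles ∧ M ∩ K = {p}}

/-- An automorphism of a Laguerre plane: a bijection of the points mapping
circles onto circles and preserving parallelity. -/
def IsAut (L : LaguerrePlane P) (σ : Equiv.Perm P) : Prop :=
  (∀ C, C ∈ L.Circles ↔ ⇑σ '' C ∈ L.Circles) ∧
  (∀ x y, L.Par x y ↔ L.Par (σ x) (σ y))

/-- The line x ⊔ y of the residual plane SA(p,K):
{x} together with the orbit of y under the stabilizer of x in Δ. -/
def line (Δ : Subgroup (Equiv.Perm P)) (x y : P) : Set P :=
  {x} ∪ {z | ∃ σ ∈ Δ, σ x = x ∧ σ y = z}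

/-- Parallelity of lines of the residual plane SA(p,K). -/
def LinePar (Δ : Subgroup (Equiv.Perm P)) (A B : Set P) : Prop :=
  ∃ σ ∈ Δ, ⇑σ '' A = B

end LaguerrePlane

open LaguerrePlane

/-- a ≡_C b : every circle through a tangent to C meets every circle through b
tangent to C. -/
def tangentEquiv {P : Type*} (L : LaguerrePlane P) (C : Set P) (a b : P) :
    Prop :=
  ∀ M ∈ L.Circles, ∀ N ∈ L.Circles, a ∈ M → b ∈ N →
    (∃ z, M ∩ C = {z}) → (∃ z, N ∩ C = {z}) → (M ∩ N).Nonempty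

namespace LaguerrePlane

variable {P : Type*}

section Basic

variable (L : LaguerrePlane P)

theorem par_refl (x : P) : L.Par x x := L.par_equiv.refl x

variable {L}

theorem Par.symm {x y : P} (h : L.Par x y) : L.Par y x := L.par_equiv.symm h

theorem Par.trans {x y z : P} (h : L.Par x y) (h' : L.Par y z) : L.Par x z :=
  L.par_equiv.trans h h'

theorem eq_of_par {C : Set P} (hC : C ∈ L.Circles) {x y : P} (hx : x ∈ C) (hy : y ∈ C)
    (h : L.Par x y) : x = y :=
  (L.parPoint x C hC).unique ⟨L.par_refl x, hx⟩ ⟨h, hy⟩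

theorem not_par_of_ne {C : Set P} (hC : C ∈ L.Circles) {x y : P} (hx : x ∈ C) (hy : y ∈ C)
    (h : x ≠ y) : ¬ L.Par x y :=
  fun h' => h (eq_of_par hC hx hy h')

theorem exists_par_mem {C : Set P} (hC : C ∈ L.Circles) (x : P) : ∃ y ∈ C, L.Par x y :=
  let ⟨y, hy, _⟩ := L.parPoint x C hC
  ⟨y, hy.2, hy.1⟩

theorem circle_eq {M N : Set P} (hM : M ∈ L.Circles) (hN : N ∈ L.Circles) {a b c : P}
    (haM : a ∈ M) (hbM : b ∈ M) (hcM : c ∈ M) (haN : a ∈ N) (hbN : b ∈ N) (hcN : c ∈ N)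
    (hab : a ≠ b) (hbc : b ≠ c) (hac : a ≠ c) : M = N :=
  (L.joinCircle a b c (not_par_of_ne hM haM hbM hab) (not_par_of_ne hM hbM hcM hbc)
    (not_par_of_ne hM haM hcM hac)).unique ⟨hM, haM, hbM, hcM⟩ ⟨hN, haN, hbN, hcN⟩

/-- Two circles tangent to `C` at the same point and sharing a point off `C` coincide. -/
theorem tangent_unique {C M N : Set P} (hC : C ∈ L.Circles) (hM : M ∈ L.Circles)
    (hN : N ∈ L.Circles) {z x : P} (hMC : M ∩ C = {z}) (hNC : N ∩ C = {z})
    (hxM : x ∈ M) (hxN : x ∈ N) (hx : x ∉ C) : M = N := by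
  have hz : z ∈ M ∩ C := hMC ▸ rfl
  have hzx : z ≠ x := fun h => hx (h ▸ hz.2)
  refine (L.touching C hC z hz.2 x hx (not_par_of_ne hM hz.1 hxM hzx)).unique
    ⟨hM, hxM, ?_⟩ ⟨hN, hxN, ?_⟩ <;> rwa [Set.inter_comm]

theorem exists_tangent {C : Set P} (hC : C ∈ L.Circles) {z x : P} (hz : z ∈ C) (hx : x ∉ C)
    (hzx : ¬ L.Par z x) : ∃ M ∈ L.Circles, x ∈ M ∧ M ∩ C = {z} := by
  obtain ⟨M, ⟨hM, hxM, h⟩, -⟩ := L.touching C hC z hz x hx hzx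
  exact ⟨M, hM, hxM, by rwa [Set.inter_comm]⟩

/-- Tangency at a fixed point is transitive. -/
theorem tangent_trans {C M N : Set P} (hC : C ∈ L.Circles) (hM : M ∈ L.Circles)
    (hN : N ∈ L.Circles) {z : P} (hMC : M ∩ C = {z}) (hNC : N ∩ C = {z}) :
    M = N ∨ M ∩ N = {z} := by
  by_contra! h
  have hz : z ∈ M ∩ C := hMC ▸ rfl
  have hz' : z ∈ N ∩ C := hNC ▸ rfl
  refine h.2 (Set.eq_singleton_iff_unique_mem.2 ⟨⟨hz.1, hz'.1⟩, fun y hy => ?_⟩)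
  by_contra hyz
  refine h.1 (tangent_unique hC hM hN hMC hNC hy.1 hy.2 fun hyC => hyz ?_)
  have : y ∈ M ∩ C := ⟨hy.1, hyC⟩
  rwa [hMC] at this

variable (L)

theorem exists_not_par_two (a b : P) : ∃ c, ¬ L.Par a c ∧ ¬ L.Par b c := by
  obtain ⟨C, hC, ⟨x, y, z, hx, hy, hz, hxy, hyz, hxz⟩, -⟩ := L.nontriv
  have hxy := not_par_of_ne hC hx hy hxy
  have hyz := not_par_of_ne hC hy hz hyz
  have hxz := not_par_of_ne hC hx hz hxz
  by_contra! h
  have key : ∀ {d u v : P}, ¬ L.Par u v → L.Par d u → ¬ L.Par d v :=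
    fun huv hu hv => huv (hu.symm.trans hv)
  have h1 := h x
  have h2 := h y
  have h3 := h z
  by_cases ax : L.Par a x
  · exact key hyz (h2 (key hxy ax)) (h3 (key hxz ax))
  · have bx := h1 ax
    by_cases ay : L.Par a y
    · exact key hxz bx (h3 (key hyz ay))
    · exact key hxy bx (h2 ay)

theorem exists_par_ne (x : P) : ∃ y, L.Par x y ∧ x ≠ y := by
  obtain ⟨C, hC, -, hne⟩ := L.nontriv
  obtain ⟨u, hu⟩ := (Set.ne_univ_iff_exists_notMem C).1 hne
  obtain ⟨v, hv, huv⟩ := exists_par_mem hC u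
  have huv' : u ≠ v := fun h => hu (h ▸ hv)
  by_cases hxu : L.Par x u
  · by_cases h : x = u
    · exact ⟨v, h ▸ huv, h ▸ huv'⟩
    · exact ⟨u, hxu, h⟩
  obtain ⟨w, hxw, huw⟩ := L.exists_not_par_two x u
  obtain ⟨D, ⟨hD, hxD, huD, hwD⟩, -⟩ := L.joinCircle x u w hxu huw hxw
  have hvD : v ∉ D := fun h => huv' (eq_of_par hD huD h huv)
  obtain ⟨M, hM, hvM, hMD⟩ := exists_tangent hD hwD hvD fun h => huw (huv.trans h.symm)
  obtain ⟨y, hy, hxy⟩ := exists_par_mem hM x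
  refine ⟨y, hxy, fun h => hxw ?_⟩
  have : x ∈ M ∩ D := ⟨h ▸ hy, hxD⟩
  rw [hMD] at this
  exact this ▸ L.par_refl x

end Basic

/-- The standing assumptions on the pencil `⟨p,K⟩` and the group `Δ`. -/
structure PencilGroup (L : LaguerrePlane P) (p : P) (K : Set P)
    (Δ : Subgroup (Equiv.Perm P)) : Prop where
  circle : K ∈ L.Circles
  mem : p ∈ K
  aut : ∀ σ ∈ Δ, L.IsAut σ
  fix : ∀ σ ∈ Δ, ∀ q, L.Par p q → σ q = q
  map_pencil : ∀ σ ∈ Δ, ∀ M ∈ L.pencil p K, ⇑σ '' M ∈ L.pencil p K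
  trans : ∀ x y : P, ¬ L.Par p x → ¬ L.Par p y → ∃ σ ∈ Δ, σ x = y
  trans_base : ∀ r ∈ K, r ≠ p → ∀ x ∈ K, x ≠ p → x ≠ r → ∀ y ∈ K, y ≠ p → y ≠ r →
    ∃ σ ∈ Δ, σ r = r ∧ σ x = y
  tangent : ∀ M ∈ L.Circles, p ∉ M → ∃! N, N ∈ L.pencil p K ∧ ∃ z, M ∩ N = {z}

/-- `a` and `b` lie in the same orbit of the stabilizer of `C` in `Δ`. -/
def SameOrbit (Δ : Subgroup (Equiv.Perm P)) (C : Set P) (a b : P) : Prop :=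
  ∃ σ ∈ Δ, ⇑σ '' C = C ∧ σ a = b

theorem SameOrbit.symm {Δ : Subgroup (Equiv.Perm P)} {C : Set P} {a b : P}
    (h : SameOrbit Δ C a b) : SameOrbit Δ C b a := by
  obtain ⟨σ, hσ, hC, rfl⟩ := h
  refine ⟨σ⁻¹, Δ.inv_mem hσ, ?_, by simp⟩
  nth_rewrite 1 [← hC]
  simp [← Set.image_comp]

theorem SameOrbit.trans {Δ : Subgroup (Equiv.Perm P)} {C : Set P} {a b c : P}
    (h : SameOrbit Δ C a b) (h' : SameOrbit Δ C b c) : SameOrbit Δ C a c := by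
  obtain ⟨σ, hσ, hC, rfl⟩ := h
  obtain ⟨τ, hτ, hC', rfl⟩ := h'
  exact ⟨τ * σ, Δ.mul_mem hτ hσ, by rw [Equiv.Perm.coe_mul, Set.image_comp, hC, hC'], rfl⟩

namespace PencilGroup

variable {L : LaguerrePlane P} {p : P} {K : Set P} {Δ : Subgroup (Equiv.Perm P)}

theorem pencil_circle (h : PencilGroup L p K Δ) {C : Set P} (hC : C ∈ L.pencil p K) :
    C ∈ L.Circles := by
  rcases hC with rfl | hC
  exacts [h.circle, hC.1]

theorem mem_pencil (h : PencilGroup L p K Δ) {C : Set P} (hC : C ∈ L.pencil p K) : p ∈ C := by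
  rcases hC with rfl | hC
  · exact h.mem
  · exact (hC.2 ▸ rfl : p ∈ C ∩ K).1

theorem not_par_of_mem (h : PencilGroup L p K Δ) {C : Set P} (hC : C ∈ L.pencil p K) {x : P}
    (hx : x ∈ C) (hxp : x ≠ p) : ¬ L.Par p x :=
  not_par_of_ne (h.pencil_circle hC) (h.mem_pencil hC) hx hxp.symm

theorem ne_of_not_par {x : P} (hx : ¬ L.Par p x) : x ≠ p :=
  fun e => hx (e ▸ L.par_refl x)

theorem tangent_mem_pencil (h : PencilGroup L p K Δ) {C M : Set P} (hC : C ∈ L.pencil p K)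
    (hM : M ∈ L.Circles) (hMC : M ∩ C = {p}) : M ∈ L.pencil p K := by
  rcases hC with rfl | hC
  · exact Or.inr ⟨hM, hMC⟩
  · rcases tangent_trans hC.1 hM h.circle hMC (by rw [Set.inter_comm]; exact hC.2) with e | e
    · exact Or.inl e
    · exact Or.inr ⟨hM, e⟩

theorem pencil_eq (h : PencilGroup L p K Δ) {C D : Set P} (hC : C ∈ L.pencil p K)
    (hD : D ∈ L.pencil p K) {x : P} (hxC : x ∈ C) (hxD : x ∈ D) (hx : x ≠ p) : C = D := by
  have aux : ∀ {E}, E ∈ L.pencil p K → E = K ∨ E ∩ K = {p} := fun hE => hE.imp id And.right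
  by_cases hxK : x ∈ K
  · have key : ∀ {E}, E ∈ L.pencil p K → x ∈ E → E = K := fun {E} hE hxE => by
      refine (aux hE).resolve_right fun e => hx ?_
      have : x ∈ E ∩ K := ⟨hxE, hxK⟩
      rwa [e] at this
    rw [key hC hxC, key hD hxD]
  · have key : ∀ {E}, E ∈ L.pencil p K → x ∈ E → E ∩ K = {p} := fun hE hxE =>
      (aux hE).resolve_left fun e => hxK (e ▸ hxE)
    exact tangent_unique h.circle (h.pencil_circle hC) (h.pencil_circle hD) (key hC hxC)
      (key hD hxD) hxC hxD hxK

theorem exists_pencil (h : PencilGroup L p K Δ) {x : P} (hx : ¬ L.Par p x) :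
    ∃ C ∈ L.pencil p K, x ∈ C := by
  by_cases hxK : x ∈ K
  · exact ⟨K, Or.inl rfl, hxK⟩
  · obtain ⟨M, hM, hxM, e⟩ := exists_tangent h.circle h.mem hxK hx
    exact ⟨M, Or.inr ⟨hM, e⟩, hxM⟩

theorem map_p (h : PencilGroup L p K Δ) {σ : Equiv.Perm P} (hσ : σ ∈ Δ) : σ p = p :=
  h.fix σ hσ p (L.par_refl p)

theorem map_circle (h : PencilGroup L p K Δ) {σ : Equiv.Perm P} (hσ : σ ∈ Δ) {M : Set P}
    (hM : M ∈ L.Circles) : σ '' M ∈ L.Circles :=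
  ((h.aut σ hσ).1 M).1 hM

theorem map_par (h : PencilGroup L p K Δ) {σ : Equiv.Perm P} (hσ : σ ∈ Δ) {x y : P}
    (hxy : L.Par x y) : L.Par (σ x) (σ y) :=
  ((h.aut σ hσ).2 x y).1 hxy

theorem map_not_par (h : PencilGroup L p K Δ) {σ : Equiv.Perm P} (hσ : σ ∈ Δ) {x : P}
    (hx : ¬ L.Par p x) : ¬ L.Par p (σ x) := fun e =>
  hx (((h.aut σ hσ).2 p x).2 (by rwa [h.map_p hσ]))

theorem map_tangent {σ : Equiv.Perm P} {M C : Set P} {z : P}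
    (hMC : M ∩ C = {z}) : σ '' M ∩ σ '' C = {σ z} := by
  rw [← Set.image_inter σ.injective, hMC, Set.image_singleton]

theorem map_pencil_eq (h : PencilGroup L p K Δ) {σ : Equiv.Perm P} (hσ : σ ∈ Δ) {C D : Set P}
    (hC : C ∈ L.pencil p K) (hD : D ∈ L.pencil p K) {x : P} (hxC : x ∈ C) (hxD : σ x ∈ D)
    (hx : x ≠ p) : σ '' C = D :=
  h.pencil_eq (h.map_pencil σ hσ C hC) hD (Set.mem_image_of_mem σ hxC) hxD fun e =>
    hx (σ.injective (e.trans (h.map_p hσ).symm))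

theorem notMem_pencil (h : PencilGroup L p K Δ) {C : Set P} (hC : C ∈ L.pencil p K) {q : P}
    (hq : L.Par p q) (hqp : q ≠ p) : q ∉ C := fun hqC =>
  h.not_par_of_mem hC hqC hqp hq

theorem notMem_of_tangent (h : PencilGroup L p K Δ) {C M : Set P} (hC : C ∈ L.pencil p K)
    {m : P} (hMC : M ∩ C = {m}) (hm : m ≠ p) : p ∉ M := fun hpM => by
  have : p ∈ M ∩ C := ⟨hpM, h.mem_pencil hC⟩
  rw [hMC] at this
  exact hm this.symm

/-- Elements of `Δ` carrying a base point to a base point carry the tangent circle over it to the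
tangent circle with the same point parallel to `p`. -/
theorem map_tangent_eq (h : PencilGroup L p K Δ) {σ : Equiv.Perm P} (hσ : σ ∈ Δ)
    {C D M N : Set P} (hC : C ∈ L.pencil p K) (hD : D ∈ L.pencil p K) (hM : M ∈ L.Circles)
    (hN : N ∈ L.Circles) {m n q : P} (hMC : M ∩ C = {m}) (hND : N ∩ D = {n}) (hm : m ≠ p)
    (hq : L.Par p q) (hqM : q ∈ M) (hqN : q ∈ N) (hmn : σ m = n) :
    σ '' M = N := by
  have hmC : m ∈ M ∩ C := hMC ▸ rfl
  have hnD : n ∈ N ∩ D := hND ▸ rfl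
  have e : σ '' C = D := h.map_pencil_eq hσ hC hD hmC.2 (hmn ▸ hnD.2) hm
  have hqp : q ≠ p := fun e => h.notMem_of_tangent hC hMC hm (e ▸ hqM)
  refine tangent_unique (h.pencil_circle hD) (h.map_circle hσ hM) hN (z := n) (x := q) ?_ hND ?_
    hqN (h.notMem_pencil hD hq hqp)
  · rw [← e, ← hmn]
    exact map_tangent hMC
  · rw [← h.fix σ hσ q hq]
    exact Set.mem_image_of_mem σ hqM

theorem trans_pencil (h : PencilGroup L p K Δ) {C : Set P} (hC : C ∈ L.pencil p K) {r x y : P}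
    (hr : r ∈ C) (hx : x ∈ C) (hy : y ∈ C) (hrp : r ≠ p) (hxp : x ≠ p) (hyp : y ≠ p)
    (hxr : x ≠ r) (hyr : y ≠ r) : ∃ σ ∈ Δ, σ r = r ∧ σ x = y := by
  have hrA := h.not_par_of_mem hC hr hrp
  obtain ⟨k, hk, hrk⟩ := exists_par_mem h.circle r
  have hkA : ¬ L.Par p k := fun e => hrA (e.trans hrk.symm)
  obtain ⟨g, hg, rfl⟩ := h.trans r k hrA hkA
  have e : g '' C = K := h.map_pencil_eq hg hC (Or.inl rfl) hr hk hrp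
  have hp : ∀ {z}, z ≠ p → g z ≠ p := fun hz e => hz (g.injective (e.trans (h.map_p hg).symm))
  have hgC : ∀ {z}, z ∈ C → g z ∈ K := fun hz => e ▸ Set.mem_image_of_mem g hz
  obtain ⟨σ, hσ, h1, h2⟩ := h.trans_base (g r) hk (hp hrp) (g x) (hgC hx) (hp hxp)
    (g.injective.ne hxr) (g y) (hgC hy) (hp hyp) (g.injective.ne hyr)
  exact ⟨g⁻¹ * σ * g, Δ.mul_mem (Δ.mul_mem (Δ.inv_mem hg) hσ) hg, by simp [h1], by simp [h2]⟩

theorem trans_tangent (h : PencilGroup L p K Δ) {C M : Set P} (hC : C ∈ L.pencil p K)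
    (hM : M ∈ L.Circles) {r x y : P} (hMC : M ∩ C = {r}) (hr : r ≠ p) (hx : x ∈ M) (hy : y ∈ M)
    (hxr : x ≠ r) (hyr : y ≠ r) (hxA : ¬ L.Par p x) (hyA : ¬ L.Par p y) :
    ∃ σ ∈ Δ, σ r = r ∧ σ '' M = M ∧ σ x = y := by
  have hrM : r ∈ M ∩ C := hMC ▸ rfl
  obtain ⟨x', hx', hxx'⟩ := exists_par_mem (h.pencil_circle hC) x
  obtain ⟨y', hy', hyy'⟩ := exists_par_mem (h.pencil_circle hC) y
  obtain ⟨q, hq, hpq⟩ := exists_par_mem hM p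
  have hxr' : x' ≠ r := fun e => hxr (eq_of_par hM hx hrM.1 (e ▸ hxx'))
  have hyr' : y' ≠ r := fun e => hyr (eq_of_par hM hy hrM.1 (e ▸ hyy'))
  have hxp : x' ≠ p := fun e => hxA (e ▸ hxx'.symm)
  have hyp : y' ≠ p := fun e => hyA (e ▸ hyy'.symm)
  obtain ⟨σ, hσ, h1, h2⟩ := h.trans_pencil hC hrM.2 hx' hy' hr hxp hyp hxr' hyr'
  have e : σ '' M = M := h.map_tangent_eq hσ hC hC hM hM hMC hMC hr hpq hq hq h1
  refine ⟨σ, hσ, h1, e, eq_of_par hM (e ▸ Set.mem_image_of_mem σ hx) hy ?_⟩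
  exact ((h.map_par hσ hxx').trans (h2 ▸ L.par_refl _)).trans hyy'.symm

/-- An element of `Δ` fixing two nonparallel points fixes every point parallel to the second. -/
theorem fix_gen (h : PencilGroup L p K Δ) {σ : Equiv.Perm P} (hσ : σ ∈ Δ) {u v x : P}
    (hu : ¬ L.Par p u) (huv : ¬ L.Par u v) (hσu : σ u = u) (hσv : σ v = v)
    (hx : L.Par v x) : σ x = x := by
  have hup := ne_of_not_par hu
  obtain ⟨C, hC, huC⟩ := h.exists_pencil hu
  have hCc := h.pencil_circle hC
  have eC : σ '' C = C := h.map_pencil_eq hσ hC hC huC (hσu.symm ▸ huC) hup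
  have hσx : L.Par x (σ x) := hx.symm.trans (hσv ▸ h.map_par hσ hx)
  by_cases hxC : x ∈ C
  · exact (eq_of_par hCc hxC (eC ▸ Set.mem_image_of_mem σ hxC) hσx).symm
  obtain ⟨M, hM, hxM, hMC⟩ := exists_tangent hCc huC hxC fun e => huv (e.trans hx.symm)
  obtain ⟨q, hq, hpq⟩ := exists_par_mem hM p
  have eM : σ '' M = M := h.map_tangent_eq hσ hC hC hM hM hMC hMC hup hpq hq hq hσu
  exact (eq_of_par hM hxM (eM ▸ Set.mem_image_of_mem σ hxM) hσx).symm

theorem map_eq_of_fix (h : PencilGroup L p K Δ) {σ : Equiv.Perm P} (hσ : σ ∈ Δ) {M : Set P}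
    (hM : M ∈ L.Circles) {a b c : P} (ha : a ∈ M) (hb : b ∈ M) (hc : c ∈ M)
    (ha' : σ a ∈ M) (hb' : σ b ∈ M) (hc' : σ c ∈ M)
    (hab : a ≠ b) (hbc : b ≠ c) (hac : a ≠ c) : σ '' M = M :=
  circle_eq (h.map_circle hσ hM) hM (Set.mem_image_of_mem σ ha) (Set.mem_image_of_mem σ hb)
    (Set.mem_image_of_mem σ hc) ha' hb' hc' (σ.injective.ne hab) (σ.injective.ne hbc)
    (σ.injective.ne hac)

/-- An element of `Δ` fixing two nonparallel points fixes everything. -/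
theorem fix_all (h : PencilGroup L p K Δ) {σ : Equiv.Perm P} (hσ : σ ∈ Δ) {u v z : P}
    (hu : ¬ L.Par p u) (hv : ¬ L.Par p v) (huv : ¬ L.Par u v) (hσu : σ u = u) (hσv : σ v = v)
    (hz : ¬ L.Par p z) (huz : ¬ L.Par u z) : σ z = z := by
  obtain ⟨q, hpq, hqp⟩ := L.exists_par_ne p
  obtain ⟨u', huu', hu'⟩ := L.exists_par_ne u
  have hσu' : σ u' = u' :=
    h.fix_gen hσ hv (fun e => huv e.symm) hσv hσu huu'
  have hσq : σ q = q := h.fix σ hσ q hpq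
  have aux : ∀ w, L.Par u w → σ w = w →
      ∃ M ∈ L.Circles, w ∈ M ∧ q ∈ M ∧ z ∈ M ∧ σ z ∈ M := by
    intro w huw hw
    have hwz : ¬ L.Par w z := fun e => huz (huw.trans e)
    have hzq : ¬ L.Par z q := fun e => hz (hpq.trans e.symm)
    have hwq : ¬ L.Par w q := fun e => hu (hpq.trans (huw.trans e).symm)
    obtain ⟨M, ⟨hM, hwM, hzM, hqM⟩, -⟩ := L.joinCircle w z q hwz hzq hwq
    obtain ⟨t, htM, hvt⟩ := exists_par_mem hM v
    have hσt : σ t = t := h.fix_gen hσ hu huv hσu hσv hvt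
    have eM : σ '' M = M := by
      refine h.map_eq_of_fix hσ hM hwM htM hqM (hw.symm ▸ hwM) (hσt.symm ▸ htM) (hσq.symm ▸ hqM)
        ?_ ?_ fun e => hwq (e ▸ L.par_refl w)
      · rintro rfl
        exact huv (huw.trans hvt.symm)
      · rintro rfl
        exact hv (hpq.trans hvt.symm)
    exact ⟨M, hM, hwM, hqM, hzM, eM ▸ Set.mem_image_of_mem σ hzM⟩
  obtain ⟨M, hM, huM, hqM, hzM, hσM⟩ := aux u (L.par_refl u) hσu
  obtain ⟨N, hN, huN, hqN, hzN, hσN⟩ := aux u' huu' hσu'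
  by_contra hne
  have e : M = N := by
    refine circle_eq hM hN hzM hσM hqM hzN hσN hqN (Ne.symm hne) ?_ ?_
    · intro e
      exact h.map_not_par hσ hz (e ▸ hpq)
    · rintro rfl
      exact hz hpq
  exact hu' (eq_of_par hM huM (e ▸ huN) huu')

/-- Among the circles tangent to pencil circles at points of a fixed generator and having a given
point parallel to `p`, at most one passes through a given point. -/
theorem base_unique (h : PencilGroup L p K Δ) {C D M N : Set P} (hC : C ∈ L.pencil p K)
    (hD : D ∈ L.pencil p K) (hM : M ∈ L.Circles) (hN : N ∈ L.Circles) {m n q x : P}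
    (hMC : M ∩ C = {m}) (hND : N ∩ D = {n}) (hm : m ≠ p) (hn : n ≠ p) (hmn : L.Par m n)
    (hq : L.Par p q) (hqM : q ∈ M) (hqN : q ∈ N) (hxM : x ∈ M) (hxN : x ∈ N)
    (hx : ¬ L.Par p x) (hmx : ¬ L.Par m x) : m = n := by
  have hmC : m ∈ M ∩ C := hMC ▸ rfl
  have hnD : n ∈ N ∩ D := hND ▸ rfl
  have hmA := h.not_par_of_mem hC hmC.2 hm
  have hnA := h.not_par_of_mem hD hnD.2 hn
  have hnx : ¬ L.Par n x := fun e => hmx (hmn.trans e)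
  obtain ⟨σ, hσ, rfl⟩ := h.trans m n hmA hnA
  have eM : σ '' M = N := h.map_tangent_eq hσ hC hD hM hN hMC hND hm hq hqM hqN rfl
  have hσx : σ x ≠ σ m := fun e => hmx (σ.injective e ▸ L.par_refl x)
  obtain ⟨ρ, hρ, h1, -, h2⟩ := h.trans_tangent hD hN hND hn (eM ▸ Set.mem_image_of_mem σ hxM) hxN
    hσx (fun e => hnx (e ▸ L.par_refl x)) (h.map_not_par hσ hx) hx
  have hg : ρ * σ ∈ Δ := Δ.mul_mem hρ hσ
  have hgm : (ρ * σ) m = σ m := h1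
  have hgx : (ρ * σ) x = x := h2
  generalize ρ * σ = g at hg hgm hgx
  obtain ⟨E, hE, hxE⟩ := h.exists_pencil hx
  obtain ⟨v, hvE, hmv⟩ := exists_par_mem (h.pencil_circle hE) m
  have eE : g '' E = E :=
    h.map_pencil_eq hg hE hE hxE (hgx.symm ▸ hxE) (ne_of_not_par hx)
  have hgv : g v = v := (eq_of_par (h.pencil_circle hE) hvE (eE ▸ Set.mem_image_of_mem g hvE)
    ((hmv.symm.trans hmn).trans (hgm ▸ h.map_par hg hmv))).symm
  rw [← hgm]
  exact (h.fix_gen hg hx (fun e => hmx (hmv.trans e.symm))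
    hgx hgv hmv.symm).symm

/-- Any two points of a pencil circle are exchanged by an element of `Δ` preserving every circle of
the pencil and fixing a third point. -/
theorem exists_swap (h : PencilGroup L p K Δ) {C : Set P} (hC : C ∈ L.pencil p K) {r s : P}
    (hr : r ∈ C) (hs : s ∈ C) (hrp : r ≠ p) (hsp : s ≠ p) (hrs : r ≠ s) :
    (∃ m, ¬ L.Par p m ∧ ¬ L.Par r m ∧ ¬ L.Par s m) ∧
    ∃ τ ∈ Δ, τ r = s ∧ ∀ E ∈ L.pencil p K, τ '' E = E := by
  have hCc := h.pencil_circle hC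
  obtain ⟨q, hpq, hqp⟩ := L.exists_par_ne p
  have hrA := h.not_par_of_mem hC hr hrp
  have hsA := h.not_par_of_mem hC hs hsp
  have hrs' := not_par_of_ne hCc hr hs hrs
  have hAq : ∀ {x}, ¬ L.Par p x → ¬ L.Par x q := fun hx e => hx (hpq.trans e.symm)
  have hAq' : ∀ {x}, ¬ L.Par p x → x ≠ q := fun hx e => hx (e ▸ hpq)
  obtain ⟨M, ⟨hM, hrM, hsM, hqM⟩, -⟩ := L.joinCircle r s q hrs' (hAq hsA) (hAq hrA)
  have hpM : p ∉ M := fun e => hqp (eq_of_par hM e hqM hpq)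
  obtain ⟨N, ⟨hN, m, hMN⟩, -⟩ := h.tangent M hM hpM
  have hmMN : m ∈ M ∩ N := hMN ▸ rfl
  have hmp : m ≠ p := fun e => hpM (e ▸ hmMN.1)
  have hmA := h.not_par_of_mem hN hmMN.2 hmp
  have aux : ∀ t, t ∈ C → t ∈ M → t ≠ p → t = m → ∀ u ∈ C, u ∈ M → u = m := by
    rintro t htC htM htp rfl u huC huM
    have e : N = C := h.pencil_eq hN hC hmMN.2 htC htp
    have : u ∈ M ∩ N := ⟨huM, e ▸ huC⟩
    rwa [hMN] at this
  have hrm : r ≠ m := fun e => hrs (e.trans (aux r hr hrM hrp e s hs hsM).symm)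
  have hsm : s ≠ m := fun e => hrs ((aux s hs hsM hsp e r hr hrM).trans e.symm)
  have hrm' := not_par_of_ne hM hrM hmMN.1 hrm
  refine ⟨⟨m, hmA, hrm', not_par_of_ne hM hsM hmMN.1 hsm⟩, ?_⟩
  obtain ⟨τ, hτ, hτm, hτM, hτr⟩ := h.trans_tangent hN hM hMN hmp hrM hsM hrm hsm hrA hsA
  have hτC : τ '' C = C := h.map_pencil_eq hτ hC hC hr (hτr.symm ▸ hs) hrp
  have hτs : τ s = r := by
    by_contra hne
    have hne' : s ≠ τ s := fun e => hrs (τ.injective (hτr.trans e))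
    have e : M = C := circle_eq hM hCc hrM hsM (hτM ▸ Set.mem_image_of_mem τ hsM) hr hs
      (hτC ▸ Set.mem_image_of_mem τ hs) hrs hne' (Ne.symm hne)
    exact hpM (e ▸ h.mem_pencil hC)
  refine ⟨τ, hτ, hτr, fun E hE => ?_⟩
  obtain ⟨e, heE, hme⟩ := exists_par_mem (h.pencil_circle hE) m
  have heA : ¬ L.Par p e := fun t => hmA (t.trans hme.symm)
  have hep := ne_of_not_par heA
  obtain ⟨M', hM', hqM', hM'E⟩ := exists_tangent (h.pencil_circle hE) heE
    (h.notMem_pencil hE hpq hqp.symm) (hAq heA)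
  obtain ⟨x, hxM', hrx⟩ := exists_par_mem hM' r
  have hxA : ¬ L.Par p x := fun t => hrA (t.trans hrx.symm)
  have hττx : τ (τ x) = x := h.fix_gen (Δ.mul_mem hτ hτ) hsA (fun t => hrs' t.symm)
    (by simp [hτs, hτr]) (by simp [hτs, hτr]) hrx
  have hsx : L.Par s (τ x) := hτr ▸ h.map_par hτ hrx
  have hxτx : ¬ L.Par x (τ x) := fun t => hrs' ((hrx.trans t).trans hsx.symm)
  have hτxA : ¬ L.Par p (τ x) := h.map_not_par hτ hxA
  obtain ⟨N', ⟨hN', hxN', hτxN', hqN'⟩, -⟩ := L.joinCircle x (τ x) q hxτx (hAq hτxA) (hAq hxA)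
  have hpN' : p ∉ N' := fun t => hqp (eq_of_par hN' t hqN' hpq)
  have eN' : τ '' N' = N' := h.map_eq_of_fix hτ hN' hxN' hτxN' hqN' hτxN' (hττx.symm ▸ hxN')
    ((h.fix τ hτ q hpq).symm ▸ hqN') (fun t => hxτx (t ▸ L.par_refl x)) (hAq' hτxA) (hAq' hxA)
  obtain ⟨F, ⟨hF, f, hN'F⟩, huniq⟩ := h.tangent N' hN' hpN'
  have hf : f ∈ N' ∩ F := hN'F ▸ rfl
  have hfp : f ≠ p := fun t => hpN' (t ▸ hf.1)
  have hfA := h.not_par_of_mem hF hf.2 hfp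
  have hτf : N' ∩ τ '' F = {τ f} := by
    have := map_tangent (σ := τ) hN'F
    rwa [eN'] at this
  have eF : τ '' F = F := huniq _ ⟨h.map_pencil τ hτ F hF, τ f, hτf⟩
  have hτff : τ f = f := by
    rw [eF, hN'F] at hτf
    exact (Set.singleton_injective hτf).symm
  have hmf : L.Par m f := by
    by_contra hmf
    have := h.fix_all hτ hmA hfA hmf hτm hτff hrA fun t => hrm' t.symm
    exact hrs (this.symm.trans hτr)
  have hef : e = f := h.base_unique hE hF hM' hN' hM'E hN'F hep hfp (hme.symm.trans hmf) hpq hqM'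
    hqN' hxM' hxN' hxA fun t => hrm' ((hme.trans t).trans hrx.symm).symm
  exact h.map_pencil_eq hτ hE hE heE (by rwa [hef, hτff, ← hef]) hep

theorem exists_mem_not_par (h : PencilGroup L p K Δ) {C : Set P} (hC : C ∈ L.pencil p K)
    (x y : P) : ∃ z ∈ C, z ≠ p ∧ ¬ L.Par x z ∧ ¬ L.Par y z := by
  have hCc := h.pencil_circle hC
  obtain ⟨m, h1, h2, h3⟩ : ∃ m, ¬ L.Par p m ∧ ¬ L.Par x m ∧ ¬ L.Par y m := by
    by_cases hx : L.Par p x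
    · obtain ⟨m, h1, h2⟩ := L.exists_not_par_two x y
      exact ⟨m, fun e => h1 (hx.symm.trans e), h1, h2⟩
    by_cases hy : L.Par p y
    · obtain ⟨m, h1, h2⟩ := L.exists_not_par_two x y
      exact ⟨m, fun e => h2 (hy.symm.trans e), h1, h2⟩
    by_cases hxy : L.Par x y
    · obtain ⟨m, h1, h2⟩ := L.exists_not_par_two p x
      exact ⟨m, h1, h2, fun e => h2 (hxy.trans e)⟩
    obtain ⟨x', hx', hxx'⟩ := exists_par_mem hCc x
    obtain ⟨y', hy', hyy'⟩ := exists_par_mem hCc y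
    obtain ⟨⟨m, h1, h2, h3⟩, -⟩ := h.exists_swap hC hx' hy' (fun e => hx (e ▸ hxx'.symm))
      (fun e => hy (e ▸ hyy'.symm)) (fun e => hxy (hxx'.trans (e ▸ hyy'.symm)))
    exact ⟨m, h1, fun e => h2 (hxx'.symm.trans e), fun e => h3 (hyy'.symm.trans e)⟩
  obtain ⟨z, hz, hmz⟩ := exists_par_mem hCc m
  exact ⟨z, hz, fun e => h1 (e ▸ hmz.symm), fun e => h2 (e.trans hmz.symm),
    fun e => h3 (e.trans hmz.symm)⟩

theorem sameOrbit_of_mem (h : PencilGroup L p K Δ) {C M : Set P} (hC : C ∈ L.pencil p K)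
    (hM : M ∈ L.Circles) {z m n : P} (hMC : M ∩ C = {z}) (hz : z ≠ p) (hm : m ∈ M) (hn : n ∈ M)
    (hmC : m ∉ C) (hnC : n ∉ C) (hmA : ¬ L.Par p m) (hnA : ¬ L.Par p n) :
    SameOrbit Δ C m n := by
  have hzC : z ∈ M ∩ C := hMC ▸ rfl
  obtain ⟨σ, hσ, h1, -, h2⟩ := h.trans_tangent hC hM hMC hz hm hn (fun e => hmC (e ▸ hzC.2))
    (fun e => hnC (e ▸ hzC.2)) hmA hnA
  exact ⟨σ, hσ, h.map_pencil_eq hσ hC hC hzC.2 (h1.symm ▸ hzC.2) hz, h2⟩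

/-- If two circles tangent to `C` at distinct points meet, then all their points off `C` and
nonparallel to `p` lie in one orbit of the stabilizer of `C`. -/
theorem sameOrbit_of_inter (h : PencilGroup L p K Δ) {C M N : Set P} (hC : C ∈ L.pencil p K)
    (hM : M ∈ L.Circles) (hN : N ∈ L.Circles) {z w m n : P} (hMC : M ∩ C = {z})
    (hNC : N ∩ C = {w}) (hz : z ≠ p) (hw : w ≠ p) (hzw : z ≠ w) (hMN : (M ∩ N).Nonempty)
    (hm : m ∈ M) (hn : n ∈ N) (hmC : m ∉ C) (hnC : n ∉ C) (hmA : ¬ L.Par p m)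
    (hnA : ¬ L.Par p n) : SameOrbit Δ C m n := by
  obtain ⟨x, hxM, hxN⟩ := hMN
  by_cases hx : L.Par p x
  · have hzC : z ∈ M ∩ C := hMC ▸ rfl
    have hwC : w ∈ N ∩ C := hNC ▸ rfl
    obtain ⟨σ, hσ, rfl⟩ := h.trans z w (h.not_par_of_mem hC hzC.2 hz)
      (h.not_par_of_mem hC hwC.2 hw)
    have e : σ '' M = N := h.map_tangent_eq hσ hC hC hM hN hMC hNC hz hx hxM hxN rfl
    have eC : σ '' C = C := h.map_pencil_eq hσ hC hC hzC.2 hwC.2 hz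
    have hσm : σ m ∉ C := fun t => hmC (by rwa [← eC, σ.injective.mem_set_image] at t)
    exact SameOrbit.trans ⟨σ, hσ, eC, rfl⟩ (h.sameOrbit_of_mem hC hN hNC hw
      (e ▸ Set.mem_image_of_mem σ hm) hn hσm hnC (h.map_not_par hσ hmA) hnA)
  · have hxC : x ∉ C := fun t => by
      have h1 : x ∈ M ∩ C := ⟨hxM, t⟩
      have h2 : x ∈ N ∩ C := ⟨hxN, t⟩
      rw [hMC] at h1
      rw [hNC] at h2
      exact hzw (h1.symm.trans h2)
    exact (h.sameOrbit_of_mem hC hM hMC hz hm hxM hmC hxC hmA hx).trans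
      (h.sameOrbit_of_mem hC hN hNC hw hxN hn hxC hnC hx hnA)

theorem inter_of_sameOrbit (h : PencilGroup L p K Δ) {C M N : Set P} (hC : C ∈ L.pencil p K)
    (hM : M ∈ L.Circles) (hN : N ∈ L.Circles) {z w m n : P} (hMC : M ∩ C = {z})
    (hNC : N ∩ C = {w}) (hz : z ≠ p) (hw : w ≠ p) (hzw : z ≠ w)
    (hm : m ∈ M) (hn : n ∈ N) (hnC : n ∉ C) (ho : SameOrbit Δ C m n) : (M ∩ N).Nonempty := by
  have hzC : z ∈ M ∩ C := hMC ▸ rfl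
  have hwC : w ∈ N ∩ C := hNC ▸ rfl
  obtain ⟨g, hg, gC, rfl⟩ := ho
  obtain ⟨q, hqM, hpq⟩ := exists_par_mem hM p
  have hgM := h.map_circle hg hM
  have hgMC : g '' M ∩ C = {g z} := by
    have := map_tangent (σ := g) hMC
    rwa [gC] at this
  have hqgM : q ∈ g '' M := h.fix g hg q hpq ▸ Set.mem_image_of_mem g hqM
  have hgm := Set.mem_image_of_mem g hm
  have hgz : g z ≠ p := fun e => hz (g.injective (e.trans (h.map_p hg).symm))
  by_cases hgzw : g z = w
  · have e : g '' M = N := tangent_unique (h.pencil_circle hC) hgM hN hgMC (hgzw ▸ hNC) hgm hn hnC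
    exact ⟨q, hqM, e ▸ hqgM⟩
  have hgzC : g z ∈ C := gC ▸ Set.mem_image_of_mem g hzC.2
  obtain ⟨k, hk, hkw, hkz⟩ := h.trans_pencil hC hwC.2 hgzC hzC.2 hw hgz hz hgzw hzw
  obtain ⟨q', hqN, hpq'⟩ := exists_par_mem hN p
  have e1 : k '' (g '' M) = M :=
    h.map_tangent_eq hk hC hC hgM hM hgMC hMC hgz hpq hqgM hqM hkz
  have e2 : k '' N = N := h.map_tangent_eq hk hC hC hN hN hNC hNC hw hpq' hqN hqN hkw
  exact ⟨k (g m), e1 ▸ Set.mem_image_of_mem k hgm, e2 ▸ Set.mem_image_of_mem k hn⟩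

theorem pencil_inter_of_sameOrbit (h : PencilGroup L p K Δ) {C D N : Set P}
    (hC : C ∈ L.pencil p K) (hD : D ∈ L.pencil p K) (hN : N ∈ L.Circles) {w a n : P}
    (hNC : N ∩ C = {w}) (hw : w ≠ p) (ha : a ∈ D) (hn : n ∈ N)
    (ho : SameOrbit Δ C a n) : (D ∩ N).Nonempty := by
  have hwC : w ∈ N ∩ C := hNC ▸ rfl
  obtain ⟨q, hqN, hpq⟩ := exists_par_mem hN p
  obtain ⟨g, hg, gC, rfl⟩ := ho.symm
  have hgN := h.map_circle hg hN
  have hgNC : g '' N ∩ C = {g w} := by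
    have := map_tangent (σ := g) hNC
    rwa [gC] at this
  have hqgN : q ∈ g '' N := h.fix g hg q hpq ▸ Set.mem_image_of_mem g hqN
  have hgn := Set.mem_image_of_mem g hn
  have hgw : g w ≠ p := fun e => hw (g.injective (e.trans (h.map_p hg).symm))
  have hgwC : g w ∈ C := gC ▸ Set.mem_image_of_mem g hwC.2
  by_cases hgww : g w = w
  · have e : g '' N = N := h.map_tangent_eq hg hC hC hN hN hNC hNC hw hpq hqN hqN hgww
    exact ⟨g n, ha, e ▸ hgn⟩
  obtain ⟨-, τ, hτ, hτw, hτD⟩ := h.exists_swap hC hgwC hwC.2 hgw hw hgww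
  have e : τ '' (g '' N) = N :=
    h.map_tangent_eq hτ hC hC hgN hN hgNC hNC hgw hpq hqgN hqN hτw
  exact ⟨τ (g n), hτD D hD ▸ Set.mem_image_of_mem τ ha, e ▸ Set.mem_image_of_mem τ hgn⟩

theorem exists_mem_off (h : PencilGroup L p K Δ) {C M : Set P} (hC : C ∈ L.pencil p K)
    (hM : M ∈ L.Circles) {z : P} (hMC : M ∩ C = {z}) : ∃ m ∈ M, m ∉ C ∧ ¬ L.Par p m := by
  obtain ⟨t, -, -, hpt, hzt⟩ := h.exists_mem_not_par hC p z
  obtain ⟨m, hm, htm⟩ := exists_par_mem hM t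
  refine ⟨m, hm, fun e => hzt ?_, fun e => hpt (e.trans htm.symm)⟩
  have : m ∈ M ∩ C := ⟨hm, e⟩
  rw [hMC] at this
  rw [← this]
  exact htm.symm

/-- Through a point off `C` there is a circle tangent to `C` away from `p` and any given point. -/
theorem exists_tangent_avoiding (h : PencilGroup L p K Δ) {C : Set P} (hC : C ∈ L.pencil p K)
    {a : P} (ha : a ∉ C) (w : P) :
    ∃ M ∈ L.Circles, a ∈ M ∧ ∃ z, M ∩ C = {z} ∧ z ≠ p ∧ z ≠ w := by
  obtain ⟨z, hz, hzp, haz, hwz⟩ := h.exists_mem_not_par hC a w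
  obtain ⟨M, hM, haM, e⟩ := exists_tangent (h.pencil_circle hC) hz ha fun e => haz e.symm
  exact ⟨M, hM, haM, z, e, hzp, fun e => hwz (e ▸ L.par_refl z)⟩

theorem sameOrbit_of_tangentEquiv (h : PencilGroup L p K Δ) {C M N : Set P}
    (hC : C ∈ L.pencil p K) {a b c : P} (hb : b ∉ C) (hab : tangentEquiv L C a b)
    (hbc : tangentEquiv L C b c) (hM : M ∈ L.Circles) (hN : N ∈ L.Circles) (ha : a ∈ M)
    (hc : c ∈ N) {z w m n : P} (hMC : M ∩ C = {z}) (hNC : N ∩ C = {w}) (hz : z ≠ p) (hw : w ≠ p)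
    (hm : m ∈ M) (hn : n ∈ N) (hmC : m ∉ C) (hnC : n ∉ C) (hmA : ¬ L.Par p m)
    (hnA : ¬ L.Par p n) : SameOrbit Δ C m n := by
  obtain ⟨B, hB, hbB, x, hBC, hx, hxz⟩ := h.exists_tangent_avoiding hC hb z
  obtain ⟨B', hB', hbB', y, hB'C, hy, hyw⟩ := h.exists_tangent_avoiding hC hb w
  obtain ⟨u, hu, huC, huA⟩ := h.exists_mem_off hC hB hBC
  obtain ⟨v, hv, hvC, hvA⟩ := h.exists_mem_off hC hB' hB'C
  have h1 : SameOrbit Δ C m u := h.sameOrbit_of_inter hC hM hB hMC hBC hz hx hxz.symm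
    (hab M hM B hB ha hbB ⟨z, hMC⟩ ⟨x, hBC⟩) hm hu hmC huC hmA huA
  have h2 : SameOrbit Δ C v n := h.sameOrbit_of_inter hC hB' hN hB'C hNC hy hw hyw
    (hbc B' hB' N hN hbB' hc ⟨y, hB'C⟩ ⟨w, hNC⟩) hv hn hvC hnC hvA hnA
  have h3 : SameOrbit Δ C u v := by
    by_cases hxy : x = y
    · have e : B = B' := tangent_unique (h.pencil_circle hC) hB hB' hBC (hxy ▸ hB'C) hbB hbB' hb
      exact h.sameOrbit_of_mem hC hB hBC hx hu (e ▸ hv) huC hvC huA hvA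
    · exact h.sameOrbit_of_inter hC hB hB' hBC hB'C hx hy hxy ⟨b, hbB, hbB'⟩ hu hv huC hvC huA hvA
  exact (h1.trans h3).trans h2

theorem tangentEquiv_symm {C : Set P} {a b : P} (hab : tangentEquiv L C a b) :
    tangentEquiv L C b a := fun M hM N hN hb ha hMC hNC => by
  rw [Set.inter_comm]
  exact hab N hN M hM ha hb hNC hMC

theorem inter_of_tangent_at_base (h : PencilGroup L p K Δ) {C D N : Set P}
    (hC : C ∈ L.pencil p K) {a b c : P} (ha : a ∉ C) (hb : b ∉ C) (hab : tangentEquiv L C a b)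
    (hbc : tangentEquiv L C b c) (hD : D ∈ L.Circles) (hN : N ∈ L.Circles) (haD : a ∈ D)
    (hc : c ∈ N) {w : P} (hDC : D ∩ C = {p}) (hNC : N ∩ C = {w}) (hw : w ≠ p) :
    (D ∩ N).Nonempty := by
  have hD' := h.tangent_mem_pencil hC hD hDC
  have haA := h.not_par_of_mem hD' haD fun e => ha (e ▸ h.mem_pencil hC)
  obtain ⟨M, hM, haM, z, hMC, hz, -⟩ := h.exists_tangent_avoiding hC ha p
  obtain ⟨n, hn, hnC, hnA⟩ := h.exists_mem_off hC hN hNC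
  exact h.pencil_inter_of_sameOrbit hC hD' hN hNC hw haD hn
    (h.sameOrbit_of_tangentEquiv hC hb hab hbc hM hN haM hc hMC hNC hz hw haM hn ha hnC haA hnA)

theorem tangentEquiv_trans (h : PencilGroup L p K Δ) {C : Set P} (hC : C ∈ L.pencil p K)
    {a b c : P} (ha : a ∉ C) (hb : b ∉ C) (hc : c ∉ C) (hab : tangentEquiv L C a b)
    (hbc : tangentEquiv L C b c) : tangentEquiv L C a c := by
  rintro M hM N hN haM hcN ⟨z, hMC⟩ ⟨w, hNC⟩
  have hzM : z ∈ M ∩ C := hMC ▸ rfl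
  have hwN : w ∈ N ∩ C := hNC ▸ rfl
  by_cases hzw : z = w
  · exact ⟨z, hzM.1, hzw ▸ hwN.1⟩
  by_cases hz : z = p
  · subst hz
    exact h.inter_of_tangent_at_base hC ha hb hab hbc hM hN haM hcN hMC hNC (Ne.symm hzw)
  by_cases hw : w = p
  · subst hw
    rw [Set.inter_comm]
    exact h.inter_of_tangent_at_base hC hc hb (tangentEquiv_symm hbc) (tangentEquiv_symm hab)
      hN hM hcN haM hNC hMC hzw
  obtain ⟨m, hm, hmC, hmA⟩ := h.exists_mem_off hC hM hMC
  obtain ⟨n, hn, hnC, hnA⟩ := h.exists_mem_off hC hN hNC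
  exact h.inter_of_sameOrbit hC hM hN hMC hNC hz hw hzw hm hn hnC
    (h.sameOrbit_of_tangentEquiv hC hb hab hbc hM hN haM hcN hMC hNC hz hw hm hn hmC hnC hmA hnA)

end PencilGroup

end LaguerrePlane

/-- assume (A3).  For every circle C ∈ ⟨p,K⟩ the relation ≡_C is
an equivalence relation on P ∖ C. -/
theorem tangentEquiv_is_equivalence
    {P : Type*} (L : LaguerrePlane P) (p : P) (K : Set P)
    (Δ : Subgroup (Equiv.Perm P))
    (hK : K ∈ L.Circles) (hpK : p ∈ K)
    (haut : ∀ σ ∈ Δ, L.IsAut σ)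
    (hfix : ∀ σ ∈ Δ, ∀ q, L.Par p q → σ q = q)
    (hpen : ∀ σ ∈ Δ, ∀ M ∈ L.pencil p K, ⇑σ '' M ∈ L.pencil p K)
    (hA1 : ∀ x y : P, ¬ L.Par p x → ¬ L.Par p y → ∃ σ ∈ Δ, σ x = y)
    (hA2 : ∀ r ∈ K, r ≠ p → ∀ x ∈ K, x ≠ p → x ≠ r → ∀ y ∈ K, y ≠ p → y ≠ r →
      ∃ σ ∈ Δ, σ r = r ∧ σ x = y)    (hA3 : ∀ M ∈ L.Circles, p ∉ M → ∃! N, N ∈ L.pencil p K ∧ ∃ z, M ∩ N = {z})    :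
    ∀ C ∈ L.pencil p K,
    (∀ a : P, a ∉ C → tangentEquiv L C a a) ∧
    (∀ a b : P, a ∉ C → b ∉ C → tangentEquiv L C a b → tangentEquiv L C b a) ∧
    (∀ a b c : P, a ∉ C → b ∉ C → c ∉ C →
      tangentEquiv L C a b → tangentEquiv L C b c → tangentEquiv L C a c) := by
  have h : PencilGroup L p K Δ := ⟨hK, hpK, haut, hfix, hpen, hA1, hA2, hA3⟩
  exact fun C hC => ⟨fun a _ M _ N _ haM haN _ _ => ⟨a, haM, haN⟩,
    fun _ _ _ _ => PencilGroup.tangentEquiv_symm,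
    fun _ _ _ ha hb hc => h.tangentEquiv_trans hC ha hb hc⟩
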